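/- Suppose a vector r ∈ ℝ^d and constants C > 0, n > 0 satisfy |e_iᵀ r| ≤ C·√(𝕍_{ii}/n) for every i ∈ [d]. Then Σ_{i=1}^d (e_iᵀ r)² ≤ C²·𝒱 / ((λ1 − λ2)²·n). -/

import Mathlib

open MeasureTheory ProbabilityTheory Matrix Real

noncomputable section

instance matrixMeasurableSpace {m n α : Type*} [MeasurableSpace α] :
    MeasurableSpace (Matrix m n α) :=
  inferInstanceAs (MeasurableSpace (m → n → α))

/-- The embedding of `Fin (d-1)` into `Fin d` skipping the first index, so that
`fsucc j` is the index of the eigenvalue `λ_{j+2}` of the paper. -/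
def fsucc {d : ℕ} (j : Fin (d - 1)) : Fin d := ⟨j.1 + 1, by have := j.2; omega⟩

/-- Euclidean (`ℓ²`) norm of a vector. -/
def norm2 {n : ℕ} (x : Fin n → ℝ) : ℝ := Real.sqrt (∑ i, x i ^ 2)

/-- `ℓ²` operator norm of a matrix. -/
def opNorm {m n : ℕ} (M : Matrix (Fin m) (Fin n) ℝ) : ℝ :=
  ‖(Matrix.toEuclideanLin M).toContinuousLinearMap‖

/-- Frobenius norm of a matrix. -/
def frobNorm {m n : ℕ} (M : Matrix (Fin m) (Fin n) ℝ) : ℝ :=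
  Real.sqrt (∑ i, ∑ j, M i j ^ 2)

/-- The matrix `V⊥ ∈ ℝ^{d×(d-1)}` whose columns are the eigenvectors `v₂, …, v_d`. -/
def Vperp {d : ℕ} (v : Fin d → Fin d → ℝ) : Matrix (Fin d) (Fin (d - 1)) ℝ :=
  Matrix.of fun i j => v (fsucc j) i

/-- `b_k := ‖V⊥ᵀ e_k‖₂`. -/
def bcoef {d : ℕ} (v : Fin d → Fin d → ℝ) (k : Fin d) : ℝ :=
  norm2 ((Vperp v)ᵀ.mulVec (Pi.single k 1))

/-- The diagonal matrix `Λ⊥` with entries `(1 + η λ_{i+1})/(1 + η λ₁)`. -/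
def Lperp {d : ℕ} (η : ℝ) (lam : Fin d → ℝ) (lam1 : ℝ) :
    Matrix (Fin (d - 1)) (Fin (d - 1)) ℝ :=
  Matrix.diagonal fun i => (1 + η * lam (fsucc i)) / (1 + η * lam1)

/-- The matrix product `B_n = (I + ηA_n)(I + ηA_{n-1})⋯(I + ηA₁)`. -/
def Bmat {d : ℕ} (n : ℕ) (η : ℝ) (A : Fin n → Matrix (Fin d) (Fin d) ℝ) :
    Matrix (Fin d) (Fin d) ℝ :=
  ((List.finRange n).reverse.map fun i => 1 + η • A i).prod

/-- The `k`-th term `T_{n,k}` of the Hoeffding decomposition of `B_n`. -/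
def Tnk {d : ℕ} (n : ℕ) (η : ℝ) (Sig : Matrix (Fin d) (Fin d) ℝ)
    (A : Fin n → Matrix (Fin d) (Fin d) ℝ) (k : ℕ) : Matrix (Fin d) (Fin d) ℝ :=
  ∑ S ∈ Finset.powersetCard k (Finset.univ : Finset (Fin n)),
    ((List.finRange n).reverse.map fun i =>
      if i ∈ S then η • (A i - Sig) else 1 + η • Sig).prod

/-- The Oja vector `B_n u₀ / ‖B_n u₀‖₂`. -/
def oja {d n : ℕ} (η : ℝ) (A : Fin n → Matrix (Fin d) (Fin d) ℝ) (u0 : Fin d → ℝ) :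
    Fin d → ℝ :=
  (norm2 ((Bmat n η A).mulVec u0))⁻¹ • (Bmat n η A).mulVec u0

/-- The Hájek projection term
`E_{n,1} = (η sign(v₁ᵀu₀)/(1+ηλ₁)) Σ_{j=1}^n V⊥ Λ⊥^{n-j} V⊥ᵀ (A_j − Σ) v₁`. -/
def En1 {d n : ℕ} (η lam1 : ℝ) (lam : Fin d → ℝ) (v : Fin d → Fin d → ℝ)
    (v1 u0 : Fin d → ℝ) (Sig : Matrix (Fin d) (Fin d) ℝ)
    (A : Fin n → Matrix (Fin d) (Fin d) ℝ) : Fin d → ℝ :=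
  (η * Real.sign (v1 ⬝ᵥ u0) / (1 + η * lam1)) •
    ∑ j : Fin n,
      (Vperp v * Lperp η lam lam1 ^ (n - 1 - j.1) * (Vperp v)ᵀ * (A j - Sig)).mulVec v1

/-- `E_{n,2} = sign(v₁ᵀu₀)(1+ηλ₁)^{-n} V⊥V⊥ᵀ (Σ_{k≥2} T_{n,k}) v₁`. -/
def En2 {d n : ℕ} (η lam1 : ℝ) (v : Fin d → Fin d → ℝ) (v1 u0 : Fin d → ℝ)
    (Sig : Matrix (Fin d) (Fin d) ℝ) (A : Fin n → Matrix (Fin d) (Fin d) ℝ) : Fin d → ℝ :=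
  (Real.sign (v1 ⬝ᵥ u0) / (1 + η * lam1) ^ n) •
    (Vperp v * (Vperp v)ᵀ * ∑ k ∈ Finset.Icc 2 n, Tnk n η Sig A k).mulVec v1

/-- `E_{n,3} = V⊥V⊥ᵀ B_n u₀ (1/‖B_n u₀‖₂ − 1/(|v₁ᵀu₀|(1+ηλ₁)^n))`. -/
def En3 {d n : ℕ} (η lam1 : ℝ) (v : Fin d → Fin d → ℝ) (v1 u0 : Fin d → ℝ)
    (A : Fin n → Matrix (Fin d) (Fin d) ℝ) : Fin d → ℝ :=
  ((norm2 ((Bmat n η A).mulVec u0))⁻¹ - (|v1 ⬝ᵥ u0| * (1 + η * lam1) ^ n)⁻¹) •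
    (Vperp v * (Vperp v)ᵀ * Bmat n η A).mulVec u0

/-- `E_{n,4} = V⊥V⊥ᵀ B_n V⊥V⊥ᵀ u₀ / (|v₁ᵀu₀|(1+ηλ₁)^n)`. -/
def En4 {d n : ℕ} (η lam1 : ℝ) (v : Fin d → Fin d → ℝ) (v1 u0 : Fin d → ℝ)
    (A : Fin n → Matrix (Fin d) (Fin d) ℝ) : Fin d → ℝ :=
  (|v1 ⬝ᵥ u0| * (1 + η * lam1) ^ n)⁻¹ •
    (Vperp v * (Vperp v)ᵀ * Bmat n η A * Vperp v * (Vperp v)ᵀ).mulVec u0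

/-- `M̃ := E[V⊥ᵀ(A − Σ)v₁v₁ᵀ(A − Σ)V⊥]`, with entrywise expectations. -/
def Mtilde {d : ℕ} {Ω : Type*} [MeasurableSpace Ω] (μ : Measure Ω)
    (Sig : Matrix (Fin d) (Fin d) ℝ) (v : Fin d → Fin d → ℝ) (v1 : Fin d → ℝ)
    (A1 : Ω → Matrix (Fin d) (Fin d) ℝ) : Matrix (Fin (d - 1)) (Fin (d - 1)) ℝ :=
  Matrix.of fun k l =>
    ∫ ω, ((Vperp v)ᵀ * (A1 ω - Sig) * vecMulVec v1 v1 * (A1 ω - Sig) * Vperp v) k l ∂μ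

/-- `R₀(k,l) := M̃_{kl}/(2λ₁ − λ_{k+1} − λ_{l+1})`. -/
def Rzero {d : ℕ} (lam1 : ℝ) (lam : Fin d → ℝ)
    (Mt : Matrix (Fin (d - 1)) (Fin (d - 1)) ℝ) : Matrix (Fin (d - 1)) (Fin (d - 1)) ℝ :=
  Matrix.of fun k l => Mt k l / (2 * lam1 - lam (fsucc k) - lam (fsucc l))

/-- `d_k := 1 − η(λ₁ − λ_{k+1})/(1 + ηλ₁)`. -/
def dfac {d : ℕ} (η lam1 : ℝ) (lam : Fin d → ℝ) (k : Fin (d - 1)) : ℝ :=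
  1 - (lam1 - lam (fsucc k)) / (1 + η * lam1) * η

/-- `R^{(n)}_{kl} := (M̃_{kl}/(1+ηλ₁)²)·(1 − (d_k d_l)^n)/(1 − d_k d_l)`. -/
def Rn {d : ℕ} (n : ℕ) (η lam1 : ℝ) (lam : Fin d → ℝ)
    (Mt : Matrix (Fin (d - 1)) (Fin (d - 1)) ℝ) : Matrix (Fin (d - 1)) (Fin (d - 1)) ℝ :=
  Matrix.of fun k l =>
    Mt k l / (1 + η * lam1) ^ 2 *
      ((1 - (dfac η lam1 lam k * dfac η lam1 lam l) ^ n) /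
        (1 - dfac η lam1 lam k * dfac η lam1 lam l))

/-- A Gram matrix of functions in `L²(μ)` is positive semidefinite. -/
lemma posSemidef_integral_mul {ι α : Type*} [Fintype ι] [MeasurableSpace α] {μ : Measure α}
    {f : ι → α → ℝ} (hf : ∀ k l, Integrable (fun a => f k a * f l a) μ) :
    (Matrix.of fun k l => ∫ a, f k a * f l a ∂μ).PosSemidef := by
  refine Matrix.PosSemidef.of_dotProduct_mulVec_nonneg ?_ fun x => ?_
  · ext k l
    simp [mul_comm]
  · have hquad : star x ⬝ᵥ (Matrix.of fun k l => ∫ a, f k a * f l a ∂μ) *ᵥ x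
        = ∫ a, (∑ k, x k * f k a) ^ 2 ∂μ := by
      have hexp : ∀ a, (∑ k, x k * f k a) ^ 2
          = ∑ k, ∑ l, x k * x l * (f k a * f l a) := fun a => by
        rw [sq, Finset.sum_mul_sum]
        exact Finset.sum_congr rfl fun k _ => Finset.sum_congr rfl fun l _ => by ring
      simp_rw [hexp]
      rw [integral_finsetSum _ fun k _ => integrable_finsetSum _ fun l _ => (hf k l).const_mul _]
      refine Finset.sum_congr rfl fun k _ => ?_
      rw [integral_finsetSum _ fun l _ => (hf k l).const_mul _]
      simp only [Pi.star_apply, star_trivial, mulVec, dotProduct, of_apply, Finset.mul_sum]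
      refine Finset.sum_congr rfl fun l _ => ?_
      rw [integral_const_mul]
      ring
    rw [hquad]
    exact integral_nonneg fun a => sq_nonneg _

/-- The Cauchy matrix `1 / (x_k + x_l)` of positive reals is positive semidefinite. -/
lemma posSemidef_cauchy {ι : Type*} [Fintype ι] {x : ι → ℝ} (hx : ∀ k, 0 < x k) :
    (Matrix.of fun k l => (x k + x l)⁻¹).PosSemidef := by
  have hmul : ∀ k l (t : ℝ), exp (-x k * t) * exp (-x l * t) = exp (-(x k + x l) * t) :=
    fun k l t => by rw [← Real.exp_add]; ring_nf
  have hneg : ∀ k l, -(x k + x l) < 0 := fun k l => by linarith [hx k, hx l]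
  have hgram := posSemidef_integral_mul (μ := volume.restrict (Set.Ioi (0 : ℝ)))
    (f := fun k t => exp (-x k * t)) fun k l => by
      simp_rw [hmul]
      exact integrableOn_exp_mul_Ioi (hneg k l) 0
  have hentry : ∀ k l, ∫ t in Set.Ioi (0 : ℝ), exp (-x k * t) * exp (-x l * t)
      = (x k + x l)⁻¹ := fun k l => by
    simp_rw [hmul]
    rw [integral_exp_mul_Ioi (hneg k l) 0, mul_zero, Real.exp_zero, neg_div_neg_eq, one_div]
  simpa only [hentry] using hgram

lemma abs_dotProduct_mulVec_le {m n : ℕ} (M : Matrix (Fin m) (Fin n) ℝ)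
    (x : Fin m → ℝ) (y : Fin n → ℝ) :
    |x ⬝ᵥ M *ᵥ y| ≤ opNorm M * (‖WithLp.toLp 2 x‖ * ‖WithLp.toLp 2 y‖) := by
  have hinner : x ⬝ᵥ M *ᵥ y
      = inner ℝ (WithLp.toLp 2 x) ((Matrix.toEuclideanLin M).toContinuousLinearMap
          (WithLp.toLp 2 y)) := by
    simp [EuclideanSpace.inner_eq_star_dotProduct, dotProduct_comm]
  rw [hinner]
  calc _ ≤ ‖WithLp.toLp 2 x‖ * ‖(Matrix.toEuclideanLin M).toContinuousLinearMap
          (WithLp.toLp 2 y)‖ := abs_real_inner_le_norm _ _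
    _ ≤ ‖WithLp.toLp 2 x‖ * (opNorm M * ‖WithLp.toLp 2 y‖) := by
        gcongr
        exact ContinuousLinearMap.le_opNorm _ _
    _ = _ := by ring

lemma abs_apply_le_opNorm {m n : ℕ} (M : Matrix (Fin m) (Fin n) ℝ) (i : Fin m) (j : Fin n) :
    |M i j| ≤ opNorm M := by
  simpa using abs_dotProduct_mulVec_le M (Pi.single i 1) (Pi.single j 1)

lemma dotProduct_mulVec_self_le {n : ℕ} (M : Matrix (Fin n) (Fin n) ℝ) {x : Fin n → ℝ}
    (hx : x ⬝ᵥ x = 1) : x ⬝ᵥ M *ᵥ x ≤ opNorm M := by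
  have hnorm : ‖WithLp.toLp 2 x‖ * ‖WithLp.toLp 2 x‖ = 1 := by
    rw [← real_inner_self_eq_norm_mul_norm, EuclideanSpace.inner_toLp_toLp, star_trivial, hx]
  simpa [hnorm] using (le_abs_self _).trans (abs_dotProduct_mulVec_le M x x)

lemma integrable_apply_mul_apply {Ω : Type*} [MeasurableSpace Ω] {μ : Measure Ω} {m n : ℕ}
    {B : Ω → Matrix (Fin m) (Fin n) ℝ} (hB : Measurable B)
    (hint : Integrable (fun ω => opNorm (B ω) ^ 2) μ) (i k : Fin m) (j l : Fin n) :
    Integrable (fun ω => B ω i j * B ω k l) μ := by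
  have hentry : ∀ i j, Measurable fun ω => B ω i j := fun i j =>
    (measurable_pi_apply j).comp ((measurable_pi_apply i).comp hB)
  refine hint.mono' ((hentry i j).mul (hentry k l)).aestronglyMeasurable
    (Filter.Eventually.of_forall fun ω => ?_)
  rw [Real.norm_eq_abs, abs_mul, sq]
  exact mul_le_mul (abs_apply_le_opNorm _ _ _) (abs_apply_le_opNorm _ _ _) (abs_nonneg _)
    (norm_nonneg _)

lemma integrable_bilin_mul_bilin {Ω : Type*} [MeasurableSpace Ω] {μ : Measure Ω} {m n : ℕ}
    {B : Ω → Matrix (Fin m) (Fin n) ℝ} (hB : Measurable B)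
    (hint : Integrable (fun ω => opNorm (B ω) ^ 2) μ) (x x' : Fin m → ℝ) (y y' : Fin n → ℝ) :
    Integrable (fun ω => (x ⬝ᵥ B ω *ᵥ y) * (x' ⬝ᵥ B ω *ᵥ y')) μ := by
  simp only [dotProduct, mulVec, Finset.mul_sum, Finset.sum_mul]
  refine integrable_finsetSum _ fun i _ => integrable_finsetSum _ fun j _ =>
    integrable_finsetSum _ fun k _ => integrable_finsetSum _ fun l _ => ?_
  refine ((integrable_apply_mul_apply hB hint k i l j).const_mul
    (x k * y l * (x' i * y' j))).congr (Filter.Eventually.of_forall fun ω => ?_)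
  ring

lemma integral_dotProduct_mulVec_self {Ω : Type*} [MeasurableSpace Ω] {μ : Measure Ω} {n : ℕ}
    {B : Ω → Matrix (Fin n) (Fin n) ℝ} (hB : Measurable B) (hsymm : ∀ ω, (B ω).IsSymm)
    (hint : Integrable (fun ω => opNorm (B ω) ^ 2) μ) (x : Fin n → ℝ) :
    ∫ ω, (B ω *ᵥ x) ⬝ᵥ (B ω *ᵥ x) ∂μ
      = x ⬝ᵥ (Matrix.of fun j k => ∫ ω, (B ω * B ω) j k ∂μ) *ᵥ x := by
  have hsq : ∀ j k, Integrable (fun ω => (B ω * B ω) j k) μ := fun j k => by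
    simp only [Matrix.mul_apply]
    exact integrable_finsetSum _ fun i _ => integrable_apply_mul_apply hB hint _ _ _ _
  have hpt : ∀ ω, (B ω *ᵥ x) ⬝ᵥ (B ω *ᵥ x) = ∑ j, ∑ k, x j * ((B ω * B ω) j k * x k) :=
    fun ω => by
      have hmove : (B ω *ᵥ x) ⬝ᵥ (B ω *ᵥ x) = x ⬝ᵥ (B ω * B ω) *ᵥ x := by
        rw [← mulVec_mulVec, dotProduct_mulVec x, ← mulVec_transpose, (hsymm ω).eq]
      rw [hmove]
      simp only [dotProduct, mulVec, Finset.mul_sum]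
  have hterm : ∀ j k, Integrable (fun ω => x j * ((B ω * B ω) j k * x k)) μ :=
    fun j k => ((hsq j k).mul_const _).const_mul _
  simp_rw [hpt]
  rw [integral_finsetSum _ fun j _ => integrable_finsetSum _ fun k _ => hterm j k]
  refine Finset.sum_congr rfl fun j _ => ?_
  rw [integral_finsetSum _ fun k _ => hterm j k]
  simp only [mulVec, dotProduct, of_apply, Finset.mul_sum]
  exact Finset.sum_congr rfl fun k _ => by rw [integral_const_mul, integral_mul_const]

lemma Vperp_transpose_mul_Vperp {d : ℕ} {v : Fin d → Fin d → ℝ}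
    (hOrth : ∀ i j, v i ⬝ᵥ v j = if i = j then (1 : ℝ) else 0) :
    (Vperp v)ᵀ * Vperp v = 1 := by
  ext k l
  have hkl : fsucc k = fsucc l ↔ k = l := by simp [fsucc, Fin.ext_iff]
  simpa [Matrix.one_apply, hkl, Matrix.mul_apply, Vperp, dotProduct]
    using hOrth (fsucc k) (fsucc l)

/-- Bessel's inequality for a matrix with orthonormal columns. -/
lemma transpose_mulVec_dotProduct_self_le {m n : Type*} [Fintype m] [Fintype n] [DecidableEq n]
    {V : Matrix m n ℝ} (hV : Vᵀ * V = 1) (w : m → ℝ) :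
    (Vᵀ *ᵥ w) ⬝ᵥ (Vᵀ *ᵥ w) ≤ w ⬝ᵥ w := by
  have hnonneg : 0 ≤ (w - V *ᵥ (Vᵀ *ᵥ w)) ⬝ᵥ (w - V *ᵥ (Vᵀ *ᵥ w)) :=
    Finset.sum_nonneg fun i _ => mul_self_nonneg _
  have hcross : w ⬝ᵥ V *ᵥ (Vᵀ *ᵥ w) = (Vᵀ *ᵥ w) ⬝ᵥ (Vᵀ *ᵥ w) := by
    rw [dotProduct_mulVec, ← mulVec_transpose]
  have hproj : (V *ᵥ (Vᵀ *ᵥ w)) ⬝ᵥ V *ᵥ (Vᵀ *ᵥ w) = (Vᵀ *ᵥ w) ⬝ᵥ (Vᵀ *ᵥ w) := by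
    rw [dotProduct_mulVec, ← mulVec_transpose, mulVec_mulVec, hV, one_mulVec]
  rw [sub_dotProduct, dotProduct_sub, dotProduct_sub, hproj, dotProduct_comm (V *ᵥ (Vᵀ *ᵥ w)) w, hcross]
    at hnonneg
  linarith

lemma Mtilde_eq_gram {d : ℕ} {Ω : Type*} [MeasurableSpace Ω] (μ : Measure Ω)
    {Sig : Matrix (Fin d) (Fin d) ℝ} (v : Fin d → Fin d → ℝ) (v1 : Fin d → ℝ)
    {A : Ω → Matrix (Fin d) (Fin d) ℝ} (hsymm : ∀ ω, (A ω - Sig).IsSymm) :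
    Mtilde μ Sig v v1 A = Matrix.of fun k l =>
      ∫ ω, (v (fsucc k) ⬝ᵥ (A ω - Sig) *ᵥ v1) * (v (fsucc l) ⬝ᵥ (A ω - Sig) *ᵥ v1) ∂μ := by
  ext k l
  refine integral_congr_ae (Filter.Eventually.of_forall fun ω => ?_)
  have hfactor : (Vperp v)ᵀ * (A ω - Sig) * vecMulVec v1 v1 * (A ω - Sig) * Vperp v
      = vecMulVec ((Vperp v)ᵀ *ᵥ ((A ω - Sig) *ᵥ v1)) ((Vperp v)ᵀ *ᵥ ((A ω - Sig) *ᵥ v1)) := by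
    rw [mul_vecMulVec, vecMulVec_mul, vecMulVec_mul, ← mulVec_mulVec,
      ← mulVec_transpose (A ω - Sig), (hsymm ω).eq, ← mulVec_transpose (Vperp v)]
  simp only [hfactor]
  rfl

lemma trace_Mtilde_le {d : ℕ} {Ω : Type*} [MeasurableSpace Ω] {μ : Measure Ω}
    {Sig : Matrix (Fin d) (Fin d) ℝ} {v : Fin d → Fin d → ℝ} {v1 : Fin d → ℝ}
    {A : Ω → Matrix (Fin d) (Fin d) ℝ}
    (hOrth : ∀ i j, v i ⬝ᵥ v j = if i = j then (1 : ℝ) else 0) (hv1 : v1 ⬝ᵥ v1 = 1)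
    (hmeas : Measurable fun ω => A ω - Sig) (hsymm : ∀ ω, (A ω - Sig).IsSymm)
    (hint : Integrable (fun ω => opNorm (A ω - Sig) ^ 2) μ) :
    (Mtilde μ Sig v v1 A).trace
      ≤ opNorm (Matrix.of fun j k => ∫ ω, ((A ω - Sig) * (A ω - Sig)) j k ∂μ) := by
  have hself : Integrable
      (fun ω => ((A ω - Sig) *ᵥ v1) ⬝ᵥ ((A ω - Sig) *ᵥ v1)) μ :=
    integrable_finsetSum _ fun i _ => by
      simpa using integrable_bilin_mul_bilin hmeas hint (Pi.single i 1) (Pi.single i 1) v1 v1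
  have hgram : ∀ k l, Integrable (fun ω => (v (fsucc k) ⬝ᵥ (A ω - Sig) *ᵥ v1) *
      (v (fsucc l) ⬝ᵥ (A ω - Sig) *ᵥ v1)) μ :=
    fun k l => integrable_bilin_mul_bilin hmeas hint _ _ _ _
  calc (Mtilde μ Sig v v1 A).trace
      = ∫ ω, ∑ k, (v (fsucc k) ⬝ᵥ (A ω - Sig) *ᵥ v1) *
          (v (fsucc k) ⬝ᵥ (A ω - Sig) *ᵥ v1) ∂μ := by
        rw [integral_finsetSum _ fun k _ => hgram k k, Mtilde_eq_gram μ v v1 hsymm]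
        rfl
    _ ≤ ∫ ω, ((A ω - Sig) *ᵥ v1) ⬝ᵥ ((A ω - Sig) *ᵥ v1) ∂μ :=
        integral_mono (integrable_finsetSum _ fun k _ => hgram k k) hself fun ω =>
          transpose_mulVec_dotProduct_self_le (Vperp_transpose_mul_Vperp hOrth) _
    _ = v1 ⬝ᵥ (Matrix.of fun j k => ∫ ω, ((A ω - Sig) * (A ω - Sig)) j k ∂μ) *ᵥ v1 :=
        integral_dotProduct_mulVec_self hmeas hsymm hint v1
    _ ≤ _ := dotProduct_mulVec_self_le _ hv1

lemma posSemidef_Rzero {d : ℕ} {lam1 : ℝ} {lam : Fin d → ℝ}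
    {M : Matrix (Fin (d - 1)) (Fin (d - 1)) ℝ} (hM : M.PosSemidef)
    (hlam : ∀ k : Fin (d - 1), lam (fsucc k) < lam1) : (Rzero lam1 lam M).PosSemidef := by
  have hhad : Rzero lam1 lam M
      = M ⊙ Matrix.of fun k l => (lam1 - lam (fsucc k) + (lam1 - lam (fsucc l)))⁻¹ := by
    ext k l
    simp only [Rzero, of_apply, hadamard_apply, div_eq_mul_inv]
    ring_nf
  rw [hhad]
  exact hM.hadamard (posSemidef_cauchy fun k => sub_pos.2 (hlam k))

lemma trace_Rzero_le {d : ℕ} {lam1 δ : ℝ} {lam : Fin d → ℝ} (hδ : 0 < δ)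
    {M : Matrix (Fin (d - 1)) (Fin (d - 1)) ℝ} (hM : M.PosSemidef)
    (hlam : ∀ k : Fin (d - 1), δ ≤ lam1 - lam (fsucc k)) :
    (Rzero lam1 lam M).trace ≤ M.trace / δ := by
  simp only [Matrix.trace, Finset.sum_div]
  refine Finset.sum_le_sum fun k _ => ?_
  exact div_le_div_of_nonneg_left hM.diag_nonneg hδ (by linarith [hlam k])

/-- entrywise bounds imply the sin² bound.
If `|e_iᵀ r| ≤ C·√(𝕍_{ii}/n)` for every `i ∈ [d]`, then
`Σ_i (e_iᵀ r)² ≤ C²·𝒱/((λ₁−λ₂)²·n)`, where `𝕍 = (λ₁−λ₂)⁻¹ V⊥ R₀ V⊥ᵀ` and `𝒱` is a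
bound on `‖E[(A−Σ)²]‖_op` for the random matrix `A` with mean `Σ`. -/
theorem stmt4 {Ω : Type*} [MeasurableSpace Ω] (μ : Measure Ω) [IsProbabilityMeasure μ]
    {d : ℕ} (hd : 2 ≤ d)
    (Sig : Matrix (Fin d) (Fin d) ℝ) (lam : Fin d → ℝ) (v : Fin d → Fin d → ℝ)
    (hSymm : Sig.IsSymm) (hPSD : Sig.PosSemidef)
    (hEig : ∀ i, Sig.mulVec (v i) = lam i • v i)
    (hOrth : ∀ i j, v i ⬝ᵥ v j = if i = j then (1 : ℝ) else 0)
    (hMono : Antitone lam) (hNonneg : ∀ i, 0 ≤ lam i)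
    (hGap : lam ⟨1, by omega⟩ < lam ⟨0, by omega⟩)
    (A : Ω → Matrix (Fin d) (Fin d) ℝ) (hAmeas : Measurable A)
    (hAsymm : ∀ ω, (A ω).IsSymm)
    (hmean : ∀ j k, ∫ ω, A ω j k ∂μ = Sig j k)
    (hint : Integrable (fun ω => opNorm (A ω - Sig) ^ 2) μ)
    (Vstat : ℝ)
    (hVstat : opNorm (Matrix.of fun j k => ∫ ω, ((A ω - Sig) * (A ω - Sig)) j k ∂μ) ≤ Vstat)
    (r : Fin d → ℝ) (C nn : ℝ) (hC : 0 < C) (hnn : 0 < nn)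
    (hbound : ∀ i : Fin d, |r i| ≤
        C * Real.sqrt
          ((((lam ⟨0, by omega⟩ - lam ⟨1, by omega⟩)⁻¹ •
              (Vperp v * Rzero (lam ⟨0, by omega⟩) lam (Mtilde μ Sig v (v ⟨0, by omega⟩) A) *
                (Vperp v)ᵀ) : Matrix (Fin d) (Fin d) ℝ) i i) / nn)) :
    ∑ i, r i ^ 2 ≤ C ^ 2 * Vstat / ((lam ⟨0, by omega⟩ - lam ⟨1, by omega⟩) ^ 2 * nn) := by
  set i0 : Fin d := ⟨0, by omega⟩
  set δ := lam i0 - lam ⟨1, by omega⟩ with hδ_def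
  set M := Mtilde μ Sig v (v i0) A with hM_def
  set R := Rzero (lam i0) lam M with hR_def
  have hδ : 0 < δ := sub_pos.2 hGap
  have hlam : ∀ k : Fin (d - 1), δ ≤ lam i0 - lam (fsucc k) := fun k =>
    sub_le_sub_left (hMono (Fin.mk_le_mk.2 (Nat.le_add_left 1 k))) _
  have hmeas : Measurable fun ω => A ω - Sig :=
    measurable_pi_lambda _ fun i => measurable_pi_lambda _ fun j =>
      ((measurable_pi_apply j).comp ((measurable_pi_apply i).comp hAmeas)).sub_const _
  have hsymm : ∀ ω, (A ω - Sig).IsSymm := fun ω => (hAsymm ω).sub hSymm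
  have hM : M.PosSemidef := by
    rw [hM_def, Mtilde_eq_gram μ v (v i0) hsymm]
    exact posSemidef_integral_mul fun k l => integrable_bilin_mul_bilin hmeas hint _ _ _ _
  have hR : R.PosSemidef :=
    posSemidef_Rzero hM fun k => sub_pos.1 (hδ.trans_le (hlam k))
  have hMtrace : M.trace ≤ Vstat :=
    (trace_Mtilde_le hOrth (by simp [hOrth]) hmeas hsymm hint).trans hVstat
  have hdiag : ∀ i, 0 ≤ (Vperp v * R * (Vperp v)ᵀ) i i := fun i => by
    simpa [conjTranspose_eq_transpose_of_trivial]
      using (hR.mul_mul_conjTranspose_same (Vperp v)).diag_nonneg (i := i)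
  have htrace : ∑ i, (Vperp v * R * (Vperp v)ᵀ) i i = R.trace := by
    change (Vperp v * R * (Vperp v)ᵀ).trace = _
    rw [Matrix.trace_mul_comm, ← Matrix.mul_assoc, Vperp_transpose_mul_Vperp hOrth,
      Matrix.one_mul]
  have hentry : ∀ i, r i ^ 2 ≤ C ^ 2 * (δ⁻¹ * (Vperp v * R * (Vperp v)ᵀ) i i / nn) := fun i => by
    have hpow := pow_le_pow_left₀ (abs_nonneg _) (hbound i) 2
    rwa [sq_abs, mul_pow, Matrix.smul_apply, smul_eq_mul, Real.sq_sqrt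
      (div_nonneg (mul_nonneg (inv_nonneg.2 hδ.le) (hdiag i)) hnn.le)] at hpow
  calc ∑ i, r i ^ 2
      ≤ ∑ i, C ^ 2 * (δ⁻¹ * (Vperp v * R * (Vperp v)ᵀ) i i / nn) :=
        Finset.sum_le_sum fun i _ => hentry i
    _ = C ^ 2 * (δ⁻¹ * R.trace / nn) := by
        rw [← Finset.mul_sum, ← Finset.sum_div, ← Finset.mul_sum, htrace]
    _ ≤ C ^ 2 * (δ⁻¹ * (Vstat / δ) / nn) := by
        gcongr
        exact (trace_Rzero_le hδ hM hlam).trans (by gcongr)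
    _ = C ^ 2 * Vstat / (δ ^ 2 * nn) := by
        field_simp
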